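/- arXiv:0903.3551 — 2 statements merged into one kernel-verified Lean document; each statement's English description precedes it below -/
import Mathlib

section
/- Let 0<q<1 and let z₁,z₂,z₃ be elements of a unital *-algebra A over ℂ satisfying the quantum 5-sphere relations. Fix N ∈ ℕ and let I_N = {(j,k,l) ∈ ℕ³ : j+k+l = N}, a set of cardinality d_N = (N+1)(N+2)/2. Define ψ_{(j,k,l)} := √([j,k,l]!) · (z₁ʲ z₂ᵏ z₃ˡ)* and ψ′_{(j,k,l)} := q^{N+j−l} √([j,k,l]!) · z₁ʲ z₂ᵏ z₃ˡ for (j,k,l) ∈ I_N. Then the matrix P ∈ Mat_{I_N}(A) with entries P_{αβ} = ψ_α (ψ_β)* is a self-adjoint idempotent (P² = P and P_{αβ}* = P_{βα}), and likewise the matrix P′ with entries P′_{αβ} = ψ′_α (ψ′_β)* is a self-adjoint idempotent. -/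
open scoped BigOperators

/-- The `q`-number `[x] = (q^x - q^(-x))/(q - q⁻¹)`. -/
noncomputable def qNum (q x : ℝ) : ℝ := (q ^ x - q ^ (-x)) / (q - q⁻¹)

/-- The `q`-factorial `[n]! = [n][n-1]⋯[1]`, with `[0]! = 1`. -/
noncomputable def qFact (q : ℝ) (n : ℕ) : ℝ := ∏ i ∈ Finset.range n, qNum q (i + 1)

/-- The `q`-trinomial coefficient `[j,k,l]! = q^{-(jk+kl+lj)} [j+k+l]!/([j]![k]![l]!)`. -/
noncomputable def qTrinom (q : ℝ) (j k l : ℕ) : ℝ :=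
  q ^ (-((j * k + k * l + l * j : ℕ) : ℝ)) * qFact q (j + k + l) /
    (qFact q j * qFact q k * qFact q l)

/-- The index set `I_N`: triples `(j,k,l)` of natural numbers with `j+k+l = N`. -/
def triples (N : ℕ) : Finset (ℕ × ℕ × ℕ) :=
  (Finset.range (N + 1) ×ˢ Finset.range (N + 1) ×ˢ Finset.range (N + 1)).filter
    (fun p => p.1 + p.2.1 + p.2.2 = N)

theorem mem_triples {N : ℕ} {p : ℕ × ℕ × ℕ} :
    p ∈ triples N ↔ p.1 + p.2.1 + p.2.2 = N := by
  simp only [triples, Finset.mem_filter, Finset.mem_product, Finset.mem_range]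
  omega

theorem card_triples (N : ℕ) : (triples N).card = (N + 1) * (N + 2) / 2 := by
  have h : (triples N).card =
      ((Finset.HasAntidiagonal.antidiagonal N).sigma fun p =>
        Finset.HasAntidiagonal.antidiagonal p.1).card := by
    refine Finset.card_nbij' (fun p => ⟨(p.1 + p.2.1, p.2.2), (p.1, p.2.1)⟩)
      (fun x => (x.2.1, x.2.2, x.1.2)) ?_ ?_ ?_ ?_
    · intro p hp
      simpa [mem_triples] using hp
    · rintro ⟨⟨a, b⟩, c, d⟩ hx
      simp only [Finset.coe_sigma, Set.mem_sigma_iff, Finset.mem_coe,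
        Finset.HasAntidiagonal.mem_antidiagonal] at hx
      simp only [Finset.mem_coe, mem_triples]
      omega
    · rintro ⟨a, b, c⟩ _
      rfl
    · rintro ⟨⟨a, b⟩, c, d⟩ hx
      simp only [Finset.coe_sigma, Set.mem_sigma_iff, Finset.mem_coe,
        Finset.HasAntidiagonal.mem_antidiagonal] at hx
      obtain ⟨_, rfl⟩ := hx
      rfl
  rw [h, Finset.card_sigma]
  simp only [Finset.Nat.card_antidiagonal]
  rw [Finset.Nat.sum_antidiagonal_eq_sum_range_succ_mk]
  have h2 := Finset.sum_range_id (N + 2)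
  rw [Finset.sum_range_succ'] at h2
  simpa [mul_comm] using h2

theorem qNum_natCast {q : ℝ} (hq : 0 < q) (n : ℕ) :
    qNum q n = (q ^ n - (q ^ n)⁻¹) / (q - q⁻¹) := by
  rw [qNum, Real.rpow_neg hq.le, Real.rpow_natCast]

theorem qNum_pos {q : ℝ} (hq : 0 < q) (hq1 : q < 1) {n : ℕ} (hn : n ≠ 0) :
    0 < qNum q n := by
  rw [qNum_natCast hq]
  have h1 : q < q⁻¹ := hq1.trans (one_lt_inv_iff₀.2 ⟨hq, hq1⟩)
  have hn1 : q ^ n < 1 := pow_lt_one₀ hq.le hq1 hn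
  have h2 : q ^ n < (q ^ n)⁻¹ :=
    hn1.trans (one_lt_inv_iff₀.2 ⟨pow_pos hq n, hn1⟩)
  exact div_pos_of_neg_of_neg (sub_neg.2 h2) (sub_neg.2 h1)

/-- Splitting of the `q`-number of a sum of three natural numbers. -/
theorem qNum_add_add {q : ℝ} (hq : 0 < q) (j k l : ℕ) :
    (q ^ (k + l))⁻¹ * qNum q j + q ^ j * (q ^ l)⁻¹ * qNum q k + q ^ (j + k) * qNum q l =
      qNum q (j + k + l : ℕ) := by
  have hne : q ≠ 0 := hq.ne'
  simp only [qNum_natCast hq, ← mul_div_assoc, ← add_div]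
  congr 1
  simp only [pow_add]
  field_simp
  ring

theorem qFact_succ (q : ℝ) (n : ℕ) :
    qFact q (n + 1) = qFact q n * qNum q (n + 1 : ℕ) := by
  simp [qFact, Finset.prod_range_succ]

theorem qFact_pos {q : ℝ} (hq : 0 < q) (hq1 : q < 1) (n : ℕ) : 0 < qFact q n := by
  refine Finset.prod_pos fun i _ => ?_
  exact_mod_cast qNum_pos hq hq1 i.succ_ne_zero

theorem qTrinom_eq {q : ℝ} (hq : 0 < q) (j k l : ℕ) :
    qTrinom q j k l = (q ^ (j * k + k * l + l * j))⁻¹ * qFact q (j + k + l) /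
      (qFact q j * qFact q k * qFact q l) := by
  rw [qTrinom, Real.rpow_neg hq.le, Real.rpow_natCast]

theorem qTrinom_nonneg {q : ℝ} (hq : 0 < q) (hq1 : q < 1) (j k l : ℕ) :
    0 ≤ qTrinom q j k l := by
  have := qFact_pos hq hq1
  rw [qTrinom_eq hq]
  exact div_nonneg (mul_nonneg (by positivity) (this _).le)
    (mul_nonneg (mul_nonneg (this _).le (this _).le) (this _).le)

theorem qTrinom_reverse (q : ℝ) (j k l : ℕ) : qTrinom q l k j = qTrinom q j k l := by
  rw [qTrinom, qTrinom]
  congr 1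
  · congr 2
    · push_cast
      ring
    · ring
  · ring

theorem qTrinom_succ_left {q : ℝ} (hq : 0 < q) (hq1 : q < 1) (j k l : ℕ) :
    qTrinom q (j + 1) k l * ((q ^ (k + l))⁻¹ * qNum q (j + 1 : ℕ)) / qNum q (j + k + l + 1 : ℕ) =
      qTrinom q j k l * (q ^ (2 * (k + l)))⁻¹ := by
  have h1 := (qNum_pos hq hq1 j.succ_ne_zero).ne'
  have h2 := (qNum_pos hq hq1 (j + k + l).succ_ne_zero).ne'
  have h3 := fun n => (qFact_pos hq hq1 n).ne'
  have hne : q ≠ 0 := hq.ne'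
  have e : j + 1 + k + l = j + k + l + 1 := by ring
  rw [qTrinom_eq hq, qTrinom_eq hq, e, qFact_succ, qFact_succ]
  field_simp [h3]
  ring

theorem qTrinom_succ_mid {q : ℝ} (hq : 0 < q) (hq1 : q < 1) (j k l : ℕ) :
    qTrinom q j (k + 1) l * (q ^ j * (q ^ l)⁻¹ * qNum q (k + 1 : ℕ)) / qNum q (j + k + l + 1 : ℕ) =
      qTrinom q j k l * (q ^ (2 * l))⁻¹ := by
  have h1 := (qNum_pos hq hq1 k.succ_ne_zero).ne'
  have h2 := (qNum_pos hq hq1 (j + k + l).succ_ne_zero).ne'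
  have h3 := fun n => (qFact_pos hq hq1 n).ne'
  have hne : q ≠ 0 := hq.ne'
  have e : j + (k + 1) + l = j + k + l + 1 := by ring
  rw [qTrinom_eq hq, qTrinom_eq hq, e, qFact_succ, qFact_succ]
  field_simp [h3]
  ring

theorem qTrinom_succ_right {q : ℝ} (hq : 0 < q) (hq1 : q < 1) (j k l : ℕ) :
    qTrinom q j k (l + 1) * (q ^ (j + k) * qNum q (l + 1 : ℕ)) / qNum q (j + k + l + 1 : ℕ) =
      qTrinom q j k l := by
  have h1 := (qNum_pos hq hq1 l.succ_ne_zero).ne'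
  have h2 := (qNum_pos hq hq1 (j + k + l).succ_ne_zero).ne'
  have h3 := fun n => (qFact_pos hq hq1 n).ne'
  have hne : q ≠ 0 := hq.ne'
  have e : j + k + (l + 1) = j + k + l + 1 := by ring
  rw [qTrinom_eq hq, qTrinom_eq hq, e, qFact_succ, qFact_succ]
  field_simp [h3]
  ring

theorem mul_pow_of_mul_eq_smul {R A : Type*} [CommSemiring R] [Semiring A] [Algebra R A]
    {r : R} {a b : A} (h : a * b = r • (b * a)) (n : ℕ) :
    a * b ^ n = r ^ n • (b ^ n * a) := by
  induction n with
  | zero => simp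
  | succ n ih =>
    rw [pow_succ, ← mul_assoc, ih, smul_mul_assoc, mul_assoc, h, mul_smul_comm, smul_smul,
      mul_assoc, pow_succ]

section Sums

variable {M : Type*} [AddCommMonoid M] (N : ℕ) (f g : ℕ → ℕ → ℕ → M)

theorem sum_triples_succ_left (h0 : ∀ k l, g 0 k l = 0)
    (h : ∀ j k l, j + k + l = N → f j k l = g (j + 1) k l) :
    ∑ p ∈ triples N, f p.1 p.2.1 p.2.2 = ∑ p ∈ triples (N + 1), g p.1 p.2.1 p.2.2 := by
  refine Finset.sum_of_injOn (fun p => (p.1 + 1, p.2.1, p.2.2)) ?_ ?_ ?_ ?_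
  · rintro ⟨a, b, c⟩ _ ⟨a', b', c'⟩ _ h
    simpa using h
  · intro p hp
    simp only [Finset.mem_coe, mem_triples] at hp ⊢
    omega
  · rintro ⟨_ | a, b, c⟩ hp hn
    · exact h0 _ _
    · refine absurd ⟨(a, b, c), ?_, rfl⟩ hn
      simp only [Finset.mem_coe, mem_triples] at hp ⊢
      omega
  · intro p hp
    exact h _ _ _ (mem_triples.1 hp)

theorem sum_triples_succ_mid (h0 : ∀ j l, g j 0 l = 0)
    (h : ∀ j k l, j + k + l = N → f j k l = g j (k + 1) l) :
    ∑ p ∈ triples N, f p.1 p.2.1 p.2.2 = ∑ p ∈ triples (N + 1), g p.1 p.2.1 p.2.2 := by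
  refine Finset.sum_of_injOn (fun p => (p.1, p.2.1 + 1, p.2.2)) ?_ ?_ ?_ ?_
  · rintro ⟨a, b, c⟩ _ ⟨a', b', c'⟩ _ h
    simpa using h
  · intro p hp
    simp only [Finset.mem_coe, mem_triples] at hp ⊢
    omega
  · rintro ⟨a, _ | b, c⟩ hp hn
    · exact h0 _ _
    · refine absurd ⟨(a, b, c), ?_, rfl⟩ hn
      simp only [Finset.mem_coe, mem_triples] at hp ⊢
      omega
  · intro p hp
    exact h _ _ _ (mem_triples.1 hp)

theorem sum_triples_succ_right (h0 : ∀ j k, g j k 0 = 0)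
    (h : ∀ j k l, j + k + l = N → f j k l = g j k (l + 1)) :
    ∑ p ∈ triples N, f p.1 p.2.1 p.2.2 = ∑ p ∈ triples (N + 1), g p.1 p.2.1 p.2.2 := by
  refine Finset.sum_of_injOn (fun p => (p.1, p.2.1, p.2.2 + 1)) ?_ ?_ ?_ ?_
  · rintro ⟨a, b, c⟩ _ ⟨a', b', c'⟩ _ h
    simpa using h
  · intro p hp
    simp only [Finset.mem_coe, mem_triples] at hp ⊢
    omega
  · rintro ⟨a, b, _ | c⟩ hp hn
    · exact h0 _ _
    · refine absurd ⟨(a, b, c), ?_, rfl⟩ hn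
      simp only [Finset.mem_coe, mem_triples] at hp ⊢
      omega
  · intro p hp
    exact h _ _ _ (mem_triples.1 hp)

theorem sum_triples_reverse :
    ∑ p ∈ triples N, f p.2.2 p.2.1 p.1 = ∑ p ∈ triples N, f p.1 p.2.1 p.2.2 := by
  refine Finset.sum_nbij' (fun p => (p.2.2, p.2.1, p.1)) (fun p => (p.2.2, p.2.1, p.1))
    ?_ ?_ (fun _ _ => rfl) (fun _ _ => rfl) (fun _ _ => rfl) <;>
  · intro p hp
    simp only [mem_triples] at hp ⊢
    omega

end Sums

/-- The trinomial expansion for three `q`-commuting elements of a `*`-algebra forming a row of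
norm one. -/
theorem sum_qTrinom_smul_mul_star {q : ℝ} (hq : 0 < q) (hq1 : q < 1)
    {A : Type*} [Ring A] [StarRing A] [Algebra ℂ A] [StarModule ℂ A] {a b c : A}
    (hab : a * b = (q : ℂ) • (b * a)) (hac : a * c = (q : ℂ) • (c * a))
    (hbc : b * c = (q : ℂ) • (c * b))
    (hone : a * star a + b * star b + c * star c = 1) (N : ℕ) :
    ∑ p ∈ triples N, (qTrinom q p.1 p.2.1 p.2.2 : ℂ) •
      ((a ^ p.1 * b ^ p.2.1 * c ^ p.2.2) * star (a ^ p.1 * b ^ p.2.1 * c ^ p.2.2)) = 1 := by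
  have hqc : (q : ℂ) ≠ 0 := by exact_mod_cast hq.ne'
  induction N with
  | zero =>
    have : triples 0 = {(0, 0, 0)} := by
      ext ⟨x, y, z⟩
      simp only [mem_triples, Finset.mem_singleton, Prod.mk.injEq]
      omega
    simp [this, qTrinom, qFact]
  | succ N ih =>
    set m : ℕ → ℕ → ℕ → A := fun j k l => a ^ j * b ^ k * c ^ l with hm
    have hma (j k l : ℕ) : m (j + 1) k l = (q : ℂ) ^ (k + l) • (m j k l * a) := by
      simp only [hm]
      rw [pow_succ, mul_assoc (a ^ j), mul_pow_of_mul_eq_smul hab, mul_smul_comm,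
        smul_mul_assoc, ← mul_assoc, mul_assoc _ a, mul_pow_of_mul_eq_smul hac,
        mul_smul_comm, smul_smul, ← mul_assoc, pow_add]
    have hmb (j k l : ℕ) : m j (k + 1) l = (q : ℂ) ^ l • (m j k l * b) := by
      simp only [hm]
      rw [pow_succ, ← mul_assoc, mul_assoc _ b, mul_pow_of_mul_eq_smul hbc,
        mul_smul_comm, ← mul_assoc]
    have hmc (j k l : ℕ) : m j k (l + 1) = m j k l * c := by
      simp only [hm]
      rw [pow_succ, ← mul_assoc]
    have hT {x y : A} {n : ℕ} (h : x = (q : ℂ) ^ n • y) :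
        y * star y = ((q : ℂ) ^ (2 * n))⁻¹ • (x * star x) := by
      have hn : (q : ℂ) ^ (2 * n) ≠ 0 := pow_ne_zero _ hqc
      rw [h, star_smul, smul_mul_smul_comm, star_pow, Complex.star_def, Complex.conj_ofReal,
        ← pow_add, ← two_mul, smul_smul, inv_mul_cancel₀ hn, one_smul]
    have hN : (qNum q (N + 1 : ℕ)) ≠ 0 := (qNum_pos hq hq1 N.succ_ne_zero).ne'
    rw [← ih]
    symm
    calc
      ∑ p ∈ triples N, (qTrinom q p.1 p.2.1 p.2.2 : ℂ) •
          (m p.1 p.2.1 p.2.2 * star (m p.1 p.2.1 p.2.2))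
        = ∑ p ∈ triples N, (qTrinom q p.1 p.2.1 p.2.2 : ℂ) •
            ((m p.1 p.2.1 p.2.2 * a) * star (m p.1 p.2.1 p.2.2 * a)) +
          ∑ p ∈ triples N, (qTrinom q p.1 p.2.1 p.2.2 : ℂ) •
            ((m p.1 p.2.1 p.2.2 * b) * star (m p.1 p.2.1 p.2.2 * b)) +
          ∑ p ∈ triples N, (qTrinom q p.1 p.2.1 p.2.2 : ℂ) •
            ((m p.1 p.2.1 p.2.2 * c) * star (m p.1 p.2.1 p.2.2 * c)) := by
          rw [← Finset.sum_add_distrib, ← Finset.sum_add_distrib]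
          refine Finset.sum_congr rfl fun p _ => ?_
          generalize m p.1 p.2.1 p.2.2 = x
          have hx : x * star x = x * a * star (x * a) + x * b * star (x * b) +
              x * c * star (x * c) := by
            calc x * star x = x * (a * star a + b * star b + c * star c) * star x := by
                  rw [hone, mul_one]
              _ = _ := by
                simp only [star_mul]
                noncomm_ring
          rw [hx, smul_add, smul_add]
      _ = ∑ p ∈ triples (N + 1), ((qTrinom q p.1 p.2.1 p.2.2 *
              ((q ^ (p.2.1 + p.2.2))⁻¹ * qNum q p.1) / qNum q (N + 1 : ℕ) : ℝ) : ℂ) •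
            (m p.1 p.2.1 p.2.2 * star (m p.1 p.2.1 p.2.2)) +
          ∑ p ∈ triples (N + 1), ((qTrinom q p.1 p.2.1 p.2.2 *
              (q ^ p.1 * (q ^ p.2.2)⁻¹ * qNum q p.2.1) / qNum q (N + 1 : ℕ) : ℝ) : ℂ) •
            (m p.1 p.2.1 p.2.2 * star (m p.1 p.2.1 p.2.2)) +
          ∑ p ∈ triples (N + 1), ((qTrinom q p.1 p.2.1 p.2.2 *
              (q ^ (p.1 + p.2.1) * qNum q p.2.2) / qNum q (N + 1 : ℕ) : ℝ) : ℂ) •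
            (m p.1 p.2.1 p.2.2 * star (m p.1 p.2.1 p.2.2)) := by
          congr 1
          · congr 1
            · refine sum_triples_succ_left N
                (fun j k l => (qTrinom q j k l : ℂ) • ((m j k l * a) * star (m j k l * a)))
                (fun j k l => ((qTrinom q j k l *
                  ((q ^ (k + l))⁻¹ * qNum q j) / qNum q (N + 1 : ℕ) : ℝ) : ℂ) •
                  (m j k l * star (m j k l))) (fun k l => by simp [qNum]) ?_
              rintro j k l rfl
              rw [qTrinom_succ_left hq hq1, hT (hma j k l), smul_smul]
              push_cast
              rfl
            · refine sum_triples_succ_mid N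
                (fun j k l => (qTrinom q j k l : ℂ) • ((m j k l * b) * star (m j k l * b)))
                (fun j k l => ((qTrinom q j k l *
                  (q ^ j * (q ^ l)⁻¹ * qNum q k) / qNum q (N + 1 : ℕ) : ℝ) : ℂ) •
                  (m j k l * star (m j k l))) (fun k l => by simp [qNum]) ?_
              rintro j k l rfl
              rw [qTrinom_succ_mid hq hq1, hT (hmb j k l), smul_smul]
              push_cast
              rfl
          · refine sum_triples_succ_right N
              (fun j k l => (qTrinom q j k l : ℂ) • ((m j k l * c) * star (m j k l * c)))
              (fun j k l => ((qTrinom q j k l *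
                (q ^ (j + k) * qNum q l) / qNum q (N + 1 : ℕ) : ℝ) : ℂ) •
                (m j k l * star (m j k l))) (fun k l => by simp [qNum]) ?_
            rintro j k l rfl
            rw [qTrinom_succ_right hq hq1, hmc]
      _ = ∑ p ∈ triples (N + 1), (qTrinom q p.1 p.2.1 p.2.2 : ℂ) •
          (m p.1 p.2.1 p.2.2 * star (m p.1 p.2.1 p.2.2)) := by
          rw [← Finset.sum_add_distrib, ← Finset.sum_add_distrib]
          refine Finset.sum_congr rfl fun p hp => ?_
          rw [← add_smul, ← add_smul, ← Complex.ofReal_add, ← Complex.ofReal_add, ← add_div,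
            ← add_div, ← mul_add, ← mul_add, qNum_add_add hq, mem_triples.1 hp,
            mul_div_cancel_right₀ _ hN]

/-- Rank-one matrices built from a column of norm one are projections. -/
theorem rankOne_isProjection {ι A : Type*} [Fintype ι] [Ring A] [StarRing A] {v : ι → A}
    (hv : ∑ i, star (v i) * v i = 1) {P : Matrix ι ι A}
    (hP : ∀ i j, P i j = v i * star (v j)) :
    P * P = P ∧ ∀ i j, star (P i j) = P j i := by
  refine ⟨?_, fun i j => by simp [hP]⟩
  ext i j
  rw [Matrix.mul_apply]
  calc ∑ k, P i k * P k j = v i * (∑ k, star (v k) * v k) * star (v j) := by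
        simp only [hP, Finset.mul_sum, Finset.sum_mul, mul_assoc]
    _ = P i j := by rw [hv, mul_one, hP]

theorem statement1
    (q : ℝ) (hq : 0 < q) (hq1 : q < 1)
    (A : Type*) [Ring A] [StarRing A] [Algebra ℂ A] [StarModule ℂ A]
    (z₁ z₂ z₃ : A)
    -- quantum 5-sphere relations
    (h12 : z₁ * z₂ = (q : ℂ) • (z₂ * z₁))
    (h13 : z₁ * z₃ = (q : ℂ) • (z₃ * z₁))
    (h23 : z₂ * z₃ = (q : ℂ) • (z₃ * z₂))
    (hs12 : star z₁ * z₂ = (q : ℂ) • (z₂ * star z₁))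
    (hs13 : star z₁ * z₃ = (q : ℂ) • (z₃ * star z₁))
    (hs21 : star z₂ * z₁ = (q : ℂ) • (z₁ * star z₂))
    (hs23 : star z₂ * z₃ = (q : ℂ) • (z₃ * star z₂))
    (hs31 : star z₃ * z₁ = (q : ℂ) • (z₁ * star z₃))
    (hs32 : star z₃ * z₂ = (q : ℂ) • (z₂ * star z₃))
    (h1 : star z₁ * z₁ = z₁ * star z₁)
    (h2 : star z₂ * z₂ - z₂ * star z₂ = ((1 - q ^ 2 : ℝ) : ℂ) • (z₁ * star z₁))
    (h3 : star z₃ * z₃ - z₃ * star z₃ =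
      ((1 - q ^ 2 : ℝ) : ℂ) • (z₁ * star z₁ + z₂ * star z₂))
    (hsphere : z₁ * star z₁ + z₂ * star z₂ + z₃ * star z₃ = 1)
    (N : ℕ)
    -- the vectors ψ and ψ′ indexed by I_N
    (ψ ψ' : {p : ℕ × ℕ × ℕ // p ∈ triples N} → A)
    (hψ : ∀ p : {p : ℕ × ℕ × ℕ // p ∈ triples N},
      ψ p = ((Real.sqrt (qTrinom q p.1.1 p.1.2.1 p.1.2.2) : ℝ) : ℂ) •
        star (z₁ ^ p.1.1 * z₂ ^ p.1.2.1 * z₃ ^ p.1.2.2))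
    (hψ' : ∀ p : {p : ℕ × ℕ × ℕ // p ∈ triples N},
      ψ' p = ((q ^ ((N : ℝ) + (p.1.1 : ℝ) - (p.1.2.2 : ℝ)) *
          Real.sqrt (qTrinom q p.1.1 p.1.2.1 p.1.2.2) : ℝ) : ℂ) •
        (z₁ ^ p.1.1 * z₂ ^ p.1.2.1 * z₃ ^ p.1.2.2))
    -- the matrices P and P′
    (P P' : Matrix {p : ℕ × ℕ × ℕ // p ∈ triples N} {p : ℕ × ℕ × ℕ // p ∈ triples N} A)
    (hP : ∀ α β, P α β = ψ α * star (ψ β))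
    (hP' : ∀ α β, P' α β = ψ' α * star (ψ' β)) :
    (triples N).card = (N + 1) * (N + 2) / 2 ∧
    (P * P = P ∧ ∀ α β, star (P α β) = P β α) ∧
    (P' * P' = P' ∧ ∀ α β, star (P' α β) = P' β α) := by
  refine ⟨card_triples N, rankOne_isProjection ?_ hP, rankOne_isProjection ?_ hP'⟩
  · rw [← sum_qTrinom_smul_mul_star hq hq1 h12 h13 h23 hsphere N]
    refine Eq.trans ?_ (Finset.sum_coe_sort (triples N) _)
    refine Finset.sum_congr rfl fun p _ => ?_
    rw [hψ, star_smul, star_star, smul_mul_smul_comm, Complex.star_def, Complex.conj_ofReal,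
      ← Complex.ofReal_mul, Real.mul_self_sqrt (qTrinom_nonneg hq hq1 _ _ _)]
  · have hqs : star (q : ℂ) = q := Complex.conj_ofReal q
    have hcomm {x y : A} (h : x * y = (q : ℂ) • (y * x)) :
        star y * star x = (q : ℂ) • (star x * star y) := by
      rw [← star_mul, h, star_smul, hqs, star_mul]
    have hsum := sum_qTrinom_smul_mul_star hq hq1 (a := star z₃) (b := (q : ℂ) • star z₂)
      (c := (q : ℂ) ^ 2 • star z₁)
      (by rw [mul_smul_comm, smul_mul_assoc, hcomm h23])
      (by rw [mul_smul_comm, smul_mul_assoc, hcomm h13, smul_comm])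
      (by rw [smul_mul_smul_comm, smul_mul_smul_comm, hcomm h12, smul_comm, mul_comm])
      (by
        rw [sub_eq_iff_eq_add] at h2 h3
        simp only [star_smul, star_star, smul_mul_smul_comm, star_pow, hqs]
        rw [h1, h2, h3, ← hsphere]
        push_cast
        module) N
    rw [← hsum, ← sum_triples_reverse N (fun j k l => (qTrinom q j k l : ℂ) •
      ((star z₃ ^ j * ((q : ℂ) • star z₂) ^ k * ((q : ℂ) ^ 2 • star z₁) ^ l) *
        star (star z₃ ^ j * ((q : ℂ) • star z₂) ^ k * ((q : ℂ) ^ 2 • star z₁) ^ l)))]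
    refine Eq.trans ?_ (Finset.sum_coe_sort (triples N) _)
    refine Finset.sum_congr rfl fun p _ => ?_
    obtain ⟨⟨j, k, l⟩, hp⟩ := p
    have hexp : q ^ ((N : ℝ) + (j : ℝ) - (l : ℝ)) = q ^ (2 * j + k) := by
      rw [← Real.rpow_natCast, ← mem_triples.1 hp]
      congr 1
      push_cast
      ring
    have hmon : star z₃ ^ l * ((q : ℂ) • star z₂) ^ k * ((q : ℂ) ^ 2 • star z₁) ^ j =
        (q : ℂ) ^ (2 * j + k) • star (z₁ ^ j * z₂ ^ k * z₃ ^ l) := by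
      simp only [smul_pow, mul_smul_comm, smul_mul_assoc, smul_smul, star_mul, star_pow,
        mul_assoc, ← pow_mul, ← pow_add]
    have hs : ((√(qTrinom q j k l) : ℝ) : ℂ) * (√(qTrinom q j k l) : ℝ) = qTrinom q j k l := by
      rw [← Complex.ofReal_mul, Real.mul_self_sqrt (qTrinom_nonneg hq hq1 j k l)]
    simp only [hψ', hexp, hmon, qTrinom_reverse q j k l]
    simp only [star_smul, star_star, smul_mul_smul_comm, smul_smul, Complex.star_def,
      Complex.conj_ofReal, map_pow]
    congr 1
    rw [← hs]
    push_cast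
    ring
end

section
/- Let 0<q<1, let μ₀,…,μ₄ be the bilinear maps of the context, and let J_{1/2}: ℂ²→ℂ² and J₁: ℂ³→ℂ³ be the conjugate-linear maps J_{1/2}(v₁,v₂) = (−q^{−1/2} conj(v₂), q^{1/2} conj(v₁)) and J₁(w₁,w₂,w₃) = (−q^{−1} conj(w₃), conj(w₂), −q conj(w₁)). Then for all v,v′ ∈ ℂ² and w,w′ ∈ ℂ³: conj(μ₀(v,v′)) = −μ₀(J_{1/2}v′, J_{1/2}v); J₁(μ₁(v,v′)) = −μ₁(J_{1/2}v′, J_{1/2}v); J_{1/2}(μ₂(v,w)) = μ₃(J₁w, J_{1/2}v); J_{1/2}(μ₃(w,v)) = μ₂(J_{1/2}v, J₁w); conj(μ₄(w,w′)) = μ₄(J₁w′, J₁w). -/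
noncomputable section

/-- `q^{1/2}` as a complex number. -/
def sqQ (q : ℝ) : ℂ := (Real.sqrt q : ℂ)

/-- `[2]^{1/2} = (q + q⁻¹)^{1/2}` as a complex number. -/
def sqTwo (q : ℝ) : ℂ := (Real.sqrt (q + q⁻¹) : ℂ)

/-- `μ₀(v,w) = [2]^{-1/2}(q^{1/2} v₁w₂ - q^{-1/2} v₂w₁)`. -/
def mu0 (q : ℝ) (v w : Fin 2 → ℂ) : ℂ :=
  (sqTwo q)⁻¹ * (sqQ q * (v 0 * w 1) - (sqQ q)⁻¹ * (v 1 * w 0))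

/-- `μ₁(v,w) = (v₁w₁, [2]^{-1/2}(q^{-1/2} v₁w₂ + q^{1/2} v₂w₁), v₂w₂)`. -/
def mu1 (q : ℝ) (v w : Fin 2 → ℂ) : Fin 3 → ℂ :=
  ![v 0 * w 0, (sqTwo q)⁻¹ * ((sqQ q)⁻¹ * (v 0 * w 1) + sqQ q * (v 1 * w 0)), v 1 * w 1]

/-- `μ₂(v,w) = (q v₁w₂ - q^{-1/2}[2]^{1/2} v₂w₁, q^{1/2}[2]^{1/2} v₁w₃ - q^{-1} v₂w₂)`. -/
def mu2 (q : ℝ) (v : Fin 2 → ℂ) (w : Fin 3 → ℂ) : Fin 2 → ℂ :=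
  ![(q : ℂ) * (v 0 * w 1) - (sqQ q)⁻¹ * sqTwo q * (v 1 * w 0),
    sqQ q * sqTwo q * (v 0 * w 2) - (q : ℂ)⁻¹ * (v 1 * w 1)]

/-- `μ₃(v,w) = (q^{1/2}[2]^{1/2} v₁w₂ - q^{-1} v₂w₁, q v₂w₂ - q^{-1/2}[2]^{1/2} v₃w₁)`. -/
def mu3 (q : ℝ) (v : Fin 3 → ℂ) (w : Fin 2 → ℂ) : Fin 2 → ℂ :=
  ![sqQ q * sqTwo q * (v 0 * w 1) - (q : ℂ)⁻¹ * (v 1 * w 0),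
    (q : ℂ) * (v 1 * w 1) - (sqQ q)⁻¹ * sqTwo q * (v 2 * w 0)]

/-- `μ₄(v,w) = q v₁w₃ - v₂w₂ + q⁻¹ v₃w₁`. -/
def mu4 (q : ℝ) (v w : Fin 3 → ℂ) : ℂ :=
  (q : ℂ) * (v 0 * w 2) - v 1 * w 1 + (q : ℂ)⁻¹ * (v 2 * w 0)

end

open ComplexConjugate

/-- The quaternionic structure `J_{1/2}` on `ℂ²`. -/
noncomputable def Jhalf (q : ℝ) (v : Fin 2 → ℂ) : Fin 2 → ℂ :=
  ![-(sqQ q)⁻¹ * conj (v 1), sqQ q * conj (v 0)]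

/-- The real structure `J₁` on `ℂ³`. -/
noncomputable def Jone (q : ℝ) (w : Fin 3 → ℂ) : Fin 3 → ℂ :=
  ![-(q : ℂ)⁻¹ * conj (w 2), conj (w 1), -(q : ℂ) * conj (w 0)]

theorem conj_sqQ (q : ℝ) : conj (sqQ q) = sqQ q := Complex.conj_ofReal _

theorem conj_sqTwo (q : ℝ) : conj (sqTwo q) = sqTwo q := Complex.conj_ofReal _

theorem sqQ_sq {q : ℝ} (hq : 0 ≤ q) : sqQ q ^ 2 = q := by
  rw [sqQ, ← Complex.ofReal_pow, Real.sq_sqrt hq]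

theorem sqQ_ne_zero {q : ℝ} (hq : 0 < q) : sqQ q ≠ 0 :=
  Complex.ofReal_ne_zero.mpr (Real.sqrt_pos.mpr hq).ne'

theorem statement11
    (q : ℝ) (hq : 0 < q) (hq1 : q < 1) :
    ∀ (v v' : Fin 2 → ℂ) (w w' : Fin 3 → ℂ),
      conj (mu0 q v v') = -mu0 q (Jhalf q v') (Jhalf q v) ∧
      Jone q (mu1 q v v') = -mu1 q (Jhalf q v') (Jhalf q v) ∧
      Jhalf q (mu2 q v w) = mu3 q (Jone q w) (Jhalf q v) ∧
      Jhalf q (mu3 q w v) = mu2 q (Jhalf q v) (Jone q w) ∧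
      conj (mu4 q w w') = mu4 q (Jone q w') (Jone q w) := by
  intro v v' w w'
  have hs := sqQ_ne_zero hq
  have cs := conj_sqQ q
  have ct := conj_sqTwo q
  have cq : conj (q : ℂ) = q := Complex.conj_ofReal q
  have hsq := sqQ_sq hq.le
  rw [← hsq] at cq
  refine ⟨?_, ?_, ?_, ?_, ?_⟩
  · simp only [mu0, Jhalf, map_mul, map_sub, map_inv₀, cs, ct, Matrix.cons_val]
    field_simp
    ring
  · ext i
    fin_cases i <;>
      simp [mu1, Jhalf, Jone, cs, ct, ← hsq] <;> field_simp <;> ring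
  · ext i
    fin_cases i <;>
      simp [mu2, mu3, Jhalf, Jone, cs, ct, ← hsq] <;> field_simp <;> ring
  · ext i
    fin_cases i <;>
      simp [mu2, mu3, Jhalf, Jone, cs, ct, ← hsq] <;> field_simp <;> ring
  · simp only [mu4, Jone, ← hsq, map_mul, map_sub, map_add, map_inv₀, cq, Matrix.cons_val]
    field_simp
end
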